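/- For every cardinal κ there exists a cardinal λ such that λ → (λ)_κ^AFP, i.e., for every group G of cardinality λ and every colouring c : G → κ there is an injective λ-sequence of elements of G all of whose adjacent finite products receive the same colour. -/

import Mathlib

universe u

open Cardinal

/-- The product `g α * g (α+1) * ⋯ * g (α+n)` of adjacent terms of the sequence `g`. -/
def adjProd {G : Type u} [Group G] (g : Ordinal.{u} → G) (α : Ordinal.{u}) : ℕ → G
  | 0 => g α
  | n + 1 => adjProd g α n * g (α + ((n : Ordinal) + 1))

/-- The set of adjacent finite products of the `μ`-sequence `g`:
`AFP(g_α | α < μ) = { g_α · g_{α+1} ⋯ g_{α+n} : α < μ, n < ω, α + n < μ }`. -/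
def AFP {G : Type u} [Group G] (μ : Ordinal.{u}) (g : Ordinal.{u} → G) : Set G :=
  { x | ∃ α < μ, ∃ n : ℕ, α + (n : Ordinal) < μ ∧ x = adjProd g α n }

/-- `G → (μ)_κ^AFP`: for every colouring `c : G → κ` there is an injective `μ`-sequence
of elements of `G` whose set of adjacent finite products is monochromatic for `c`. -/
def ArrowAFP (G : Type u) [Group G] (μ : Ordinal.{u}) (κ : Cardinal.{u}) : Prop :=
  ∀ c : G → κ.out, ∃ g : Ordinal.{u} → G,
    (∀ α < μ, ∀ β < μ, g α = g β → α = β) ∧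
    ∃ i : κ.out, ∀ x ∈ AFP μ g, c x = i

/-- The Erdős tree order of a colouring `f` of pairs of a well-order: `x` precedes `y` if `x < y`
and `y` has the same colours as `x` towards all tree predecessors of `x`. -/
def ErdosTree {X K : Type u} [LinearOrder X] [WellFoundedLT X] (f : X → X → K) (x y : X) : Prop :=
  x < y ∧ ∀ z, ∀ _ : z < x, ErdosTree f z x → f z x = f z y
termination_by wellFounded_lt.wrap x

namespace ErdosTree

variable {X K : Type u} [LinearOrder X] [WellFoundedLT X] {f : X → X → K} {x x' y y' z : X}

theorem iff : ErdosTree f x y ↔ x < y ∧ ∀ z, ErdosTree f z x → f z x = f z y := by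
  have lt {a b : X} (h : ErdosTree f a b) : a < b := by
    unfold ErdosTree at h
    exact h.1
  constructor
  · intro h
    unfold ErdosTree at h
    exact ⟨h.1, fun z hz => h.2 z (lt hz) hz⟩
  · intro h
    unfold ErdosTree
    exact ⟨h.1, fun z _ hz => h.2 z hz⟩

theorem lt (h : ErdosTree f x y) : x < y := (iff.1 h).1

theorem colour_eq (h : ErdosTree f x y) (hz : ErdosTree f z x) : f z x = f z y :=
  (iff.1 h).2 z hz

theorem trans (hxy : ErdosTree f x y) (hyz : ErdosTree f y z) : ErdosTree f x z := by
  induction x using WellFoundedLT.induction generalizing y z with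
  | _ x ih =>
    refine iff.2 ⟨hxy.lt.trans hyz.lt, fun w hw => ?_⟩
    rw [hxy.colour_eq hw, hyz.colour_eq (ih w hw.lt hw hxy)]

/-- The tree predecessors of a point form a chain. -/
theorem of_lt (hx : ErdosTree f x y) (hx' : ErdosTree f x' y) (h : x < x') :
    ErdosTree f x x' := by
  induction x using WellFoundedLT.induction with
  | _ x ih =>
    refine iff.2 ⟨h, fun w hw => ?_⟩
    rw [hx.colour_eq hw, hx'.colour_eq (ih w hw.lt (hw.trans hx) (hw.lt.trans h))]

instance isWellFounded (f : X → X → K) : IsWellFounded X (ErdosTree f) :=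
  ⟨Subrelation.wf (fun h => lt h) wellFounded_lt⟩

/-- The height of a point in the Erdős tree. -/
noncomputable abbrev rank (f : X → X → K) (x : X) : Ordinal.{u} :=
  IsWellFounded.rank (ErdosTree f) x

theorem rank_lt (h : ErdosTree f x y) : rank f x < rank f y :=
  IsWellFounded.rank_lt_of_rel h

theorem of_rank_lt (hx : ErdosTree f x y) (hx' : ErdosTree f x' y) (h : rank f x < rank f x') :
    ErdosTree f x x' := by
  rcases lt_trichotomy x x' with h' | rfl | h'
  · exact hx.of_lt hx' h'
  · exact absurd h (lt_irrefl _)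
  · exact absurd h (hx'.of_lt hx h').rank_lt.not_gt

theorem eq_of_rank_eq (hx : ErdosTree f x y) (hx' : ErdosTree f x' y)
    (h : rank f x = rank f x') : x = x' := by
  rcases lt_trichotomy x x' with h' | h' | h'
  · exact absurd h (hx.of_lt hx' h').rank_lt.ne
  · exact h'
  · exact absurd h (hx'.of_lt hx h').rank_lt.ne'

theorem exists_rank_eq {o : Ordinal.{u}} (h : o < rank f y) :
    ∃ x, ErdosTree f x y ∧ rank f x = o := by
  induction y using WellFoundedLT.induction with
  | _ y ih =>
    rw [rank, IsWellFounded.rank_eq, Ordinal.lt_iSup_iff] at h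
    obtain ⟨⟨b, hb⟩, ho⟩ := h
    rw [Order.lt_succ_iff] at ho
    obtain rfl | ho := ho.eq_or_lt
    · exact ⟨b, hb, rfl⟩
    · obtain ⟨x, hx, rfl⟩ := ih b hb.lt ho
      exact ⟨x, hx.trans hb, rfl⟩

/-- A point is determined by the colours towards its tree predecessors, listed by height. -/
theorem not_lt_of_forall_colour
    (h : ∀ o k, (∃ x, ErdosTree f x y ∧ rank f x = o ∧ f x y = k) ↔
      ∃ x, ErdosTree f x y' ∧ rank f x = o ∧ f x y' = k) : ¬ y < y' := by
  intro hlt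
  have key : ∀ o x x', ErdosTree f x y → ErdosTree f x' y' → rank f x = o → rank f x' = o →
      x = x' := by
    intro o
    induction o using WellFoundedLT.induction with
    | _ o ih =>
      intro x x' hx hx' ho ho'
      rcases lt_trichotomy x x' with hxx | hxx | hxx
      · refine absurd (ho.trans ho'.symm) (rank_lt (iff.2 ⟨hxx, fun z hz => ?_⟩)).ne
        obtain ⟨w, hw, hwr, hwk⟩ := (h (rank f z) (f z y)).1 ⟨z, hz.trans hx, rfl, rfl⟩
        obtain rfl := ih _ (ho ▸ hz.rank_lt) z w (hz.trans hx) hw rfl hwr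
        rw [hx.colour_eq hz, ← hwk, hx'.colour_eq (hw.of_lt hx' (hz.lt.trans hxx))]
      · exact hxx
      · refine absurd (ho'.trans ho.symm) (rank_lt (iff.2 ⟨hxx, fun z hz => ?_⟩)).ne
        obtain ⟨w, hw, hwr, hwk⟩ := (h (rank f z) (f z y')).2 ⟨z, hz.trans hx', rfl, rfl⟩
        obtain rfl := ih _ (ho' ▸ hz.rank_lt) w z hw (hz.trans hx') hwr rfl
        rw [hx'.colour_eq hz, ← hwk, hx.colour_eq (hw.of_lt hx (hz.lt.trans hxx))]
  have hy : ErdosTree f y y' := by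
    refine iff.2 ⟨hlt, fun z hz => ?_⟩
    obtain ⟨w, hw, hwr, hwk⟩ := (h (rank f z) (f z y)).1 ⟨z, hz, rfl, rfl⟩
    obtain rfl := key _ z w hz hw rfl hwr
    exact hwk.symm
  obtain ⟨x, hx, hxr, -⟩ := (h (rank f y) (f y y')).2 ⟨y, hy, rfl, rfl⟩
  exact hx.rank_lt.ne hxr

end ErdosTree

theorem exists_strictMono_nat {α : Type*} [LinearOrder α] [WellFoundedLT α] [Infinite α] :
    ∃ h : ℕ → α, StrictMono h := by
  let f := Infinite.natEmbedding α
  obtain ⟨g, hg | hg⟩ := exists_increasing_or_nonincreasing_subseq (· < ·) f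
  · exact ⟨f ∘ g, fun m n h => hg m n h⟩
  · have hanti : StrictAnti (f ∘ g) := fun m n h =>
      lt_of_le_of_ne (not_lt.1 (hg m n h)) fun e => h.ne' (g.injective (f.injective e))
    exact absurd wellFounded_lt (RelEmbedding.natGT (r := ((· < ·) : α → α → Prop)) (f ∘ g)
      (fun n => hanti n.lt_succ_self)).not_wellFounded

/-- A weak form of the Erdős–Rado theorem. -/
theorem exists_homogeneous_sequence {X K : Type u} (f : X → X → K)
    (hX : 2 ^ Order.succ (max #K ℵ₀) < #X) :
    ∃ h : ℕ → X, Function.Injective h ∧ ∃ i, ∀ m n, m < n → f (h m) (h n) = i := by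
  obtain ⟨_, _⟩ := exists_wellFoundedLT X
  set ν := Order.succ (max #K ℵ₀) with hν
  have hKν : #K < ν := (le_max_left _ _).trans_lt (Order.lt_succ _)
  have hων : ℵ₀ ≤ ν := (le_max_right _ _).trans (Order.le_succ _)
  let ι := ν.ord.ToType
  have hι : #ι = ν := by simp [ι]
  have : Infinite ι := by rwa [infinite_iff, hι]
  let e : ι → Ordinal.{u} := fun t => (Ordinal.ToType.mk.symm t).1
  have e_strictMono : StrictMono e := fun s t h => Ordinal.ToType.mk.symm.strictMono h
  by_cases hy : ∃ y, ν.ord ≤ ErdosTree.rank f y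
  · obtain ⟨y, hy⟩ := hy
    have hx (t : ι) : ∃ x, ErdosTree f x y ∧ ErdosTree.rank f x = e t :=
      ErdosTree.exists_rank_eq ((Ordinal.ToType.mk.symm t).2.trans_le hy)
    choose x hxy hxr using hx
    obtain ⟨i, hi⟩ := exists_infinite_fiber (fun t => f (x t) y) (hKν.trans_eq hι.symm)
    obtain ⟨s, hs⟩ := exists_strictMono_nat (α := ((fun t => f (x t) y) ⁻¹' {i} : Set ι))
    have hlt (m n : ℕ) (h : m < n) : ErdosTree f (x (s m)) (x (s n)) :=
      (hxy _).of_rank_lt (hxy _) (by rw [hxr, hxr]; exact e_strictMono (hs h))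
    refine ⟨fun n => x (s n), StrictMono.injective fun m n h => (hlt m n h).lt, i,
      fun m n h => ?_⟩
    rw [(hxy (s n)).colour_eq (hlt m n h)]
    exact (s m).2
  · push Not at hy
    exfalso
    let φ : X → Set (ι × K) := fun y =>
      {p | ∃ x, ErdosTree f x y ∧ ErdosTree.rank f x = e p.1 ∧ f x y = p.2}
    have hφ (y y' : X) (h : φ y = φ y') (o : Ordinal.{u}) (k : K)
        (hy' : ∃ x, ErdosTree f x y ∧ ErdosTree.rank f x = o ∧ f x y = k) :
        ∃ x, ErdosTree f x y' ∧ ErdosTree.rank f x = o ∧ f x y' = k := by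
      obtain ⟨x, hx, rfl, hk⟩ := hy'
      let t : ι := Ordinal.ToType.mk ⟨ErdosTree.rank f x, hy x⟩
      have ht : e t = ErdosTree.rank f x := by simp [e, t]
      have hmem : (t, k) ∈ φ y := ⟨x, hx, ht.symm, hk⟩
      rw [h] at hmem
      simpa only [φ, Set.mem_ofPred_eq, ht] using hmem
    have hφ' (y y' : X) (h : φ y = φ y') : ¬ y < y' :=
      ErdosTree.not_lt_of_forall_colour fun o k => ⟨hφ y y' h o k, hφ y' y h.symm o k⟩
    have hinj : Function.Injective φ := fun y y' h =>
      le_antisymm (not_lt.1 (hφ' y' y h.symm)) (not_lt.1 (hφ' y y' h))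
    refine absurd (mk_le_of_injective hinj) (not_le.2 (lt_of_le_of_lt ?_ hX))
    rw [mk_set, mk_prod, lift_id, lift_id, hι]
    exact power_le_power_left two_ne_zero
      ((mul_le_mul_right hKν.le ν).trans (mul_eq_self hων).le)

theorem Subgroup.mk_closure_le {G : Type u} [Group G] (A : Set G) :
    #(Subgroup.closure A) ≤ max #A ℵ₀ := by
  rw [FreeGroup.closure_eq_range]
  have hfree : #(FreeGroup A) ≤ #(List (A × Bool)) := mk_le_of_surjective (f := FreeGroup.mk)
    fun x => Quot.inductionOn x fun L => ⟨L, rfl⟩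
  refine (mk_le_of_surjective (MonoidHom.rangeRestrict_surjective _)).trans
    (hfree.trans ((mk_list_le_max _).trans (max_le (le_max_right _ _) ?_)))
  have hbool : lift.{u} #Bool ≤ max #A ℵ₀ := by simp
  rw [mk_prod, lift_uzero]
  exact (mul_le_mul' (le_max_left _ _) hbool).trans (mul_eq_self (le_max_right _ _)).le

/-- An injective sequence of consecutive quotients `(h k)⁻¹ * h (k + 1)`, where all quotients
`(h m)⁻¹ * h n` with `m < n` have colour `i`. -/
def IsQuotientBlock {G K : Type u} [Group G] (c : G → K) (i : K) (b : ℕ → G) : Prop :=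
  Function.Injective b ∧ ∃ h : ℕ → G, (∀ k, b k = (h k)⁻¹ * h (k + 1)) ∧
    ∀ m n, m < n → c ((h m)⁻¹ * h n) = i

section Group

variable {G : Type u} [Group G]

/-- An injective sequence has a subsequence whose consecutive quotients are distinct. -/
theorem exists_strictMono_injective_quotients {h : ℕ → G} (hh : Function.Injective h) :
    ∃ φ : ℕ → ℕ, StrictMono φ ∧
      Function.Injective fun k => (h (φ k))⁻¹ * h (φ (k + 1)) := by
  have hnext (n : ℕ) : ∃ m, n < m ∧ ∀ a ≤ n, ∀ b ≤ n, (h n)⁻¹ * h m ≠ (h a)⁻¹ * h b := by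
    let F : Set G := (fun p : ℕ × ℕ => h n * ((h p.1)⁻¹ * h p.2)) '' (Set.Iic n ×ˢ Set.Iic n)
    have hF : F.Finite := ((Set.finite_Iic n).prod (Set.finite_Iic n)).image _
    have hfin : (h ⁻¹' F).Finite := hF.preimage hh.injOn
    obtain ⟨m, hm, hnm⟩ := hfin.infinite_compl.exists_gt n
    refine ⟨m, hnm, fun a ha b hb hab => hm ⟨(a, b), ⟨ha, hb⟩, ?_⟩⟩
    simp [← hab]
  choose next hlt hne using hnext
  let φ : ℕ → ℕ := fun k => next^[k] 0
  have hφ (k : ℕ) : φ (k + 1) = next (φ k) := Function.iterate_succ_apply' next k 0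
  have hmono : StrictMono φ := strictMono_nat_of_lt_succ fun k => hφ k ▸ hlt _
  have key (j k : ℕ) (hjk : j < k) :
      (h (φ k))⁻¹ * h (φ (k + 1)) ≠ (h (φ j))⁻¹ * h (φ (j + 1)) := by
    rw [hφ k]
    exact hne _ _ (hmono.monotone hjk.le) _ (hmono.monotone hjk)
  refine ⟨φ, hmono, fun j k hjk => ?_⟩
  by_contra hne'
  rcases lt_or_gt_of_ne hne' with hlt' | hlt'
  · exact key j k hlt' hjk.symm
  · exact key k j hlt' hjk

/-- Monochromatic blocks can be found away from any small set. -/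
theorem exists_isQuotientBlock_disjoint {K : Type u} (c : G → K) {ν : Cardinal.{u}}
    (hν : ν = 2 ^ Order.succ (max #K ℵ₀)) (hG : ν < #G) (A : Set G) (hA : #A ≤ ν) :
    ∃ i b, IsQuotientBlock c i b ∧ Disjoint (Set.range b) A := by
  have hων : ℵ₀ ≤ ν := hν ▸ (le_max_right _ _).trans ((Order.le_succ _).trans (cantor _).le)
  let H := Subgroup.closure A
  have hH : #H ≤ ν := (Subgroup.mk_closure_le A).trans (max_le hA hων)
  have hquot : ν < #(G ⧸ H) := by
    by_contra! hle
    refine hG.not_ge ?_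
    rw [mk_congr (Subgroup.groupEquivQuotientProdSubgroup (s := H)), mk_prod, lift_id, lift_id]
    exact (mul_le_mul' hle hH).trans (mul_eq_self hων).le
  obtain ⟨q, hq, i, hi⟩ := exists_homogeneous_sequence
    (fun x y : G ⧸ H => c (x.out⁻¹ * y.out)) (hν ▸ hquot)
  obtain ⟨φ, hφ, hinj⟩ := exists_strictMono_injective_quotients (h := fun n => (q n).out)
    (Quotient.out_injective.comp hq)
  refine ⟨i, _, ⟨hinj, fun k => (q (φ k)).out, fun _ => rfl, fun m n h => hi _ _ (hφ h)⟩, ?_⟩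
  rw [Set.disjoint_left]
  rintro _ ⟨k, rfl⟩ hk
  have heq : q (φ k) = q (φ (k + 1)) := by
    rw [← QuotientGroup.out_eq' (q (φ k)), ← QuotientGroup.out_eq' (q (φ (k + 1)))]
    exact QuotientGroup.eq.2 (Subgroup.subset_closure hk)
  exact (hφ k.lt_succ_self).ne (hq heq)

/-- There are many pairwise disjoint monochromatic blocks of one colour. -/
theorem exists_large_family_isQuotientBlock {K : Type u} (c : G → K) {ν : Cardinal.{u}}
    (hν : ν = 2 ^ Order.succ (max #K ℵ₀)) (hG : ν < #G) :
    ∃ i, ∃ S : Set (ℕ → G), ν < #S ∧ (∀ b ∈ S, IsQuotientBlock c i b) ∧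
      S.PairwiseDisjoint Set.range := by
  have hων : ℵ₀ ≤ ν := hν ▸ (le_max_right _ _).trans ((Order.le_succ _).trans (cantor _).le)
  have hKν : #K ≤ ν := hν ▸ (le_max_left _ _).trans ((Order.le_succ _).trans (cantor _).le)
  have hmax (i : K) : ∃ S, Maximal (· ∈ {S : Set (ℕ → G) |
      (∀ b ∈ S, IsQuotientBlock c i b) ∧ S.PairwiseDisjoint Set.range}) S := by
    refine zorn_subset _ fun C hC hchain => ⟨⋃₀ C, ⟨?_, ?_⟩, fun s => Set.subset_sUnion_of_mem⟩
    · rintro b ⟨s, hs, hb⟩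
      exact (hC hs).1 b hb
    · exact (Set.pairwiseDisjoint_sUnion hchain.directedOn).2 fun s hs => (hC hs).2
  choose S hS using hmax
  by_contra! hcon
  have hle (i : K) : #(S i) ≤ ν := by
    by_contra! hlt
    exact hcon i (S i) hlt (hS i).1.1 (hS i).1.2
  let A : Set G := ⋃ p : Σ i, S i, Set.range p.2.1
  have hA : #A ≤ ν := by
    have hsum : #(Σ i, S i) ≤ ν := by
      rw [mk_sigma]
      exact (sum_le_mk_mul_iSup _).trans ((mul_le_mul' hKν (ciSup_le' hle)).trans
        (mul_eq_self hων).le)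
    have hsup : ⨆ p : Σ i, S i, #(Set.range p.2.1) ≤ ν :=
      ciSup_le' fun p => (Set.countable_range p.2.1).le_aleph0.trans hων
    exact (mk_iUnion_le _).trans ((mul_le_mul' hsum hsup).trans (mul_eq_self hων).le)
  obtain ⟨i, b, hb, hbA⟩ := exists_isQuotientBlock_disjoint c hν hG A hA
  have hdisj (b' : ℕ → G) (hb' : b' ∈ S i) : Disjoint (Set.range b) (Set.range b') :=
    hbA.mono_right (Set.subset_iUnion (fun p : Σ i, S i => Set.range p.2.1) ⟨i, b', hb'⟩)
  have hmem : b ∈ S i := by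
    refine (hS i).2 ⟨?_, ?_⟩ (Set.subset_insert b (S i)) (Set.mem_insert _ _)
    · rintro b' (rfl | hb')
      exacts [hb, (hS i).1.1 b' hb']
    · exact (hS i).1.2.insert fun b' hb' _ => hdisj b' hb'
  exact Set.disjoint_left.1 (hdisj b hmem) ⟨0, rfl⟩ ⟨0, rfl⟩

/-- Adjacent products of consecutive quotients telescope. -/
theorem adjProd_eq_of_quotients {g : Ordinal.{u} → G} {α : Ordinal.{u}} {h : ℕ → G} {m : ℕ}
    (hg : ∀ n : ℕ, g (α + n) = (h (m + n))⁻¹ * h (m + n + 1)) (n : ℕ) :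
    adjProd g α n = (h m)⁻¹ * h (m + n + 1) := by
  induction n with
  | zero => simpa [adjProd] using hg 0
  | succ n ih =>
    have hn := hg (n + 1)
    push_cast at hn
    rw [adjProd, ih, hn, ← add_assoc]
    group

end Group

open Ordinal in
/-- Concatenating disjoint blocks of length `ω` yields a sequence of length `μ`. -/
theorem exists_sequence_of_blocks {G K : Type u} [Group G] {c : G → K} {i : K}
    {S : Set (ℕ → G)} {μ : Ordinal.{u}} (hμ : μ.card ≤ #S)
    (hS : ∀ b ∈ S, IsQuotientBlock c i b) (hdisj : S.PairwiseDisjoint Set.range) :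
    ∃ g : Ordinal.{u} → G, (∀ α < μ, ∀ β < μ, g α = g β → α = β) ∧ ∀ x ∈ AFP μ g, c x = i := by
  rw [← mk_toType] at hμ
  obtain ⟨e⟩ := hμ
  have hmod (α : Ordinal.{u}) : ∃ n : ℕ, α % ω = n := lt_omega0.1 (mod_lt α omega0_ne_zero)
  choose r hr using hmod
  have hdiv {α : Ordinal.{u}} (hα : α < μ) : α / ω < μ :=
    (Ordinal.div_le_of_le_mul (Ordinal.le_mul_right α omega0_pos)).trans_lt hα
  classical
  let B : Ordinal.{u} → ℕ → G := fun q =>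
    if hq : q < μ then (e (ToType.mk ⟨q, hq⟩)).1 else 1
  have hBmem {q : Ordinal.{u}} (hq : q < μ) : B q ∈ S := by
    simp only [B, dif_pos hq]
    exact (e _).2
  have hBinj {q q' : Ordinal.{u}} (hq : q < μ) (hq' : q' < μ) (h : B q = B q') : q = q' := by
    simp only [B, dif_pos hq, dif_pos hq'] at h
    exact congrArg Subtype.val (ToType.mk.injective (e.injective (Subtype.ext h)))
  refine ⟨fun α => B (α / ω) (r α), fun α hα β hβ hαβ => ?_, ?_⟩
  · have hB : B (α / ω) = B (β / ω) := by
      by_contra hne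
      exact Set.disjoint_left.1 (hdisj (hBmem (hdiv hα)) (hBmem (hdiv hβ)) hne)
        ⟨r α, rfl⟩ ⟨r β, hαβ.symm⟩
    have hrr : r α = r β := (hS _ (hBmem (hdiv hα))).1 (hαβ.trans (by rw [hB]))
    rw [← div_add_mod α ω, ← div_add_mod β ω, hr, hr, hrr, hBinj (hdiv hα) (hdiv hβ) hB]
  · rintro _ ⟨α, hα, n, -, rfl⟩
    obtain ⟨-, h, hh, hc⟩ := hS _ (hBmem (hdiv hα))
    rw [adjProd_eq_of_quotients (h := h) (m := r α)]
    · exact hc _ _ (by omega)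
    · intro k
      have hlt : ((r α + k : ℕ) : Ordinal.{u}) < ω := natCast_lt_omega0 _
      have hα' : α + k = ω * (α / ω) + (r α + k : ℕ) := by
        rw [Nat.cast_add, ← hr, ← add_assoc, div_add_mod]
      have hquot : (α + k) / ω = α / ω := by
        rw [hα', mul_add_div _ omega0_ne_zero, div_eq_zero_of_lt hlt, add_zero]
      have hrem : r (α + k) = r α + k := by
        have := hr (α + k)
        rw [hα', mul_add_mod_self, mod_eq_of_lt hlt, ← hα'] at this
        exact_mod_cast this.symm
      simp only [hquot, hrem, hh]

/-- For every cardinal `κ` there is a cardinal `λ` such that `λ → (λ)_κ^AFP`. -/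
theorem exists_lambda_arrow_lambda_AFP (κ : Cardinal.{u}) :
    ∃ lam : Cardinal.{u}, ∀ (G : Type u) [Group G], #G = lam → ArrowAFP G lam.ord κ := by
  let ν : Cardinal.{u} := 2 ^ Order.succ (max κ ℵ₀)
  refine ⟨Order.succ ν, fun G _ hG c => ?_⟩
  obtain ⟨i, S, hcard, hS, hdisj⟩ := exists_large_family_isQuotientBlock (ν := ν) c
    (by rw [mk_out]) (by rw [hG]; exact Order.lt_succ _)
  obtain ⟨g, hg, hc⟩ := exists_sequence_of_blocks (μ := (Order.succ ν).ord)
    (by rw [card_ord]; exact Order.succ_le_of_lt hcard) hS hdisj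
  exact ⟨g, hg, i, hc⟩
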